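/- arXiv:2208.12245 — 4 statements merged into one kernel-verified Lean document; each statement's English description precedes it below -/
import Mathlib

section
/- For every α ∈ (0,1), the function f_α is strictly increasing on [0, x_α], strictly decreasing on [x_α, 1], and attains its global maximum over [0,1] uniquely at x_α; moreover x_α ∈ (0, 1). -/
open Finset

/-- `f_α(x) = (1−α)x(1−x)/(α+(1−α)x²)`. -/
noncomputable def f (α x : ℝ) : ℝ := (1 - α) * x * (1 - x) / (α + (1 - α) * x ^ 2)

/-- `x_α = sqrt((α/(1−α))² + α/(1−α)) − α/(1−α)`, the maximiser of `f_α` on `[0,1]`. -/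
noncomputable def xc (α : ℝ) : ℝ :=
  Real.sqrt ((α / (1 - α)) ^ 2 + α / (1 - α)) - α / (1 - α)

theorem xc_mem_Ioo {α : ℝ} (hα : α ∈ Set.Ioo (0 : ℝ) 1) : xc α ∈ Set.Ioo (0 : ℝ) 1 := by
  have hc : 0 < α / (1 - α) := div_pos hα.1 (sub_pos.2 hα.2)
  unfold xc
  constructor
  · rw [sub_pos]
    exact Real.lt_sqrt_of_sq_lt (by linarith)
  · rw [sub_lt_iff_lt_add, Real.sqrt_lt' (by linarith)]
    nlinarith

/-- The critical point equation satisfied by `xc α`. -/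
theorem xc_quadratic {α : ℝ} (hα : α ∈ Set.Ioo (0 : ℝ) 1) :
    (1 - α) * xc α ^ 2 + 2 * α * xc α = α := by
  have h1 : 0 < 1 - α := sub_pos.2 hα.2
  have hc : 0 < α / (1 - α) := div_pos hα.1 h1
  have hmul : (1 - α) * (α / (1 - α)) = α := mul_div_cancel₀ α h1.ne'
  have hs := Real.sq_sqrt (show 0 ≤ (α / (1 - α)) ^ 2 + α / (1 - α) by positivity)
  unfold xc
  generalize Real.sqrt ((α / (1 - α)) ^ 2 + α / (1 - α)) = s at *
  generalize α / (1 - α) = c at *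
  linear_combination (1 - α) * hs + (1 + 2 * c - 2 * s) * hmul

theorem f_denom_pos {α : ℝ} (hα : α ∈ Set.Ioo (0 : ℝ) 1) (x : ℝ) :
    0 < α + (1 - α) * x ^ 2 :=
  add_pos_of_pos_of_nonneg hα.1 (mul_nonneg (sub_nonneg.2 hα.2.le) (sq_nonneg x))

theorem f_sub_f {α : ℝ} (hα : α ∈ Set.Ioo (0 : ℝ) 1) (x y : ℝ) :
    f α y - f α x = (1 - α) * (y - x) *
      ((1 - α) * (xc α ^ 2 - x * y) + α * ((xc α - x) + (xc α - y))) /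
        ((α + (1 - α) * y ^ 2) * (α + (1 - α) * x ^ 2)) := by
  unfold f
  rw [div_sub_div _ _ (f_denom_pos hα y).ne' (f_denom_pos hα x).ne']
  congr 1
  linear_combination -(1 - α) * (y - x) * xc_quadratic hα

theorem f_strictMonoOn {α : ℝ} (hα : α ∈ Set.Ioo (0 : ℝ) 1) :
    StrictMonoOn (f α) (Set.Icc 0 (xc α)) := by
  intro x hx y hy hxy
  have h1 : 0 < 1 - α := sub_pos.2 hα.2
  rw [← sub_pos, f_sub_f hα]
  refine div_pos (mul_pos (mul_pos h1 (sub_pos.2 hxy)) ?_)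
    (mul_pos (f_denom_pos hα y) (f_denom_pos hα x))
  refine add_pos_of_nonneg_of_pos (mul_nonneg h1.le ?_)
    (mul_pos hα.1 (by linarith [hx.2, hy.2]))
  nlinarith [mul_le_mul hx.2 hy.2 hy.1 (hx.1.trans hx.2)]

theorem f_strictAntiOn {α : ℝ} (hα : α ∈ Set.Ioo (0 : ℝ) 1) :
    StrictAntiOn (f α) (Set.Ici (xc α)) := by
  intro x hx y hy hxy
  rw [Set.mem_Ici] at hx hy
  have h1 : 0 < 1 - α := sub_pos.2 hα.2
  have hz := (xc_mem_Ioo hα).1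
  rw [← sub_neg, f_sub_f hα]
  refine div_neg_of_neg_of_pos (mul_neg_of_pos_of_neg (mul_pos h1 (sub_pos.2 hxy)) ?_)
    (mul_pos (f_denom_pos hα y) (f_denom_pos hα x))
  refine add_neg_of_nonpos_of_neg (mul_nonpos_of_nonneg_of_nonpos h1.le ?_)
    (mul_neg_of_pos_of_neg hα.1 (by linarith))
  nlinarith [mul_le_mul hx hy hz.le (hz.le.trans hx)]

/-- `f_α` is strictly increasing on `[0, x_α]`, strictly decreasing on `[x_α, 1]`, attains its
global maximum over `[0,1]` uniquely at `x_α`, and `x_α ∈ (0,1)`. -/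
theorem f_monotonicity (α : ℝ) (hα : α ∈ Set.Ioo (0 : ℝ) 1) :
    StrictMonoOn (f α) (Set.Icc 0 (xc α)) ∧
    StrictAntiOn (f α) (Set.Icc (xc α) 1) ∧
    (∀ x ∈ Set.Icc (0 : ℝ) 1, x ≠ xc α → f α x < f α (xc α)) ∧
    xc α ∈ Set.Ioo (0 : ℝ) 1 := by
  refine ⟨f_strictMonoOn hα, (f_strictAntiOn hα).mono Set.Icc_subset_Ici_self, ?_, xc_mem_Ioo hα⟩
  intro x hx hne
  have hz := (xc_mem_Ioo hα).1.le
  rcases hne.lt_or_gt with h | h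
  · exact f_strictMonoOn hα ⟨hx.1, h.le⟩ ⟨hz, le_rfl⟩ h
  · exact f_strictAntiOn hα Set.self_mem_Ici h.le h
end

section
/- Let r_α = f_α(x_α) = max_{x ∈ [0,1]} f_α(x). If α ∈ (1/9, 1), then r_α < 1; if α ∈ (0, 1/9), then r_α > 1. -/
open Finset

/-- `r_α = f_α(x_α)`, the maximum of `f_α` over `[0,1]`. -/
noncomputable def r (α : ℝ) : ℝ := f α (xc α)

/-- The point `xc α` is a positive root of the numerator of the derivative of `f α`. -/
lemma xc_pos_and_quadratic {α : ℝ} (h0 : 0 < α) (h1 : α < 1) :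
    0 < xc α ∧ (1 - α) * xc α ^ 2 = α * (1 - 2 * xc α) := by
  have hb : 0 < 1 - α := sub_pos.mpr h1
  have ht : 0 < α / (1 - α) := div_pos h0 hb
  have hmul : (1 - α) * (α / (1 - α)) = α := by field_simp
  unfold xc
  set t := α / (1 - α)
  have hs : Real.sqrt (t ^ 2 + t) ^ 2 = t ^ 2 + t := Real.sq_sqrt (by positivity)
  refine ⟨sub_pos.mpr (Real.lt_sqrt_of_sq_lt (by linarith)), ?_⟩
  linear_combination (1 - α) * hs + (1 - 2 * (Real.sqrt (t ^ 2 + t) - t)) * hmul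

lemma xc_lt_half {α : ℝ} (h0 : 0 < α) (h1 : α < 1) : xc α < 1 / 2 := by
  obtain ⟨hc, hq⟩ := xc_pos_and_quadratic h0 h1
  have hpos : 0 < α * (1 - 2 * xc α) := hq ▸ mul_pos (sub_pos.mpr h1) (pow_pos hc 2)
  linarith [pos_of_mul_pos_right hpos h0.le]

lemma r_eq {α : ℝ} (h0 : 0 < α) (h1 : α < 1) : r α = (1 - 2 * xc α) / (2 * xc α) := by
  obtain ⟨hc, hq⟩ := xc_pos_and_quadratic h0 h1
  have hb : 0 < 1 - α := sub_pos.mpr h1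
  have hden : 0 < α + (1 - α) * xc α ^ 2 := by positivity
  unfold r f
  rw [div_eq_div_iff hden.ne' (by positivity)]
  linear_combination hq

lemma f_le_r {α : ℝ} (h0 : 0 < α) (h1 : α < 1) (x : ℝ) : f α x ≤ r α := by
  obtain ⟨hc, hq⟩ := xc_pos_and_quadratic h0 h1
  have hb : 0 < 1 - α := sub_pos.mpr h1
  have hden : 0 < α + (1 - α) * x ^ 2 := by positivity
  rw [r_eq h0 h1]
  unfold f
  rw [div_le_div_iff₀ hden (by positivity)]
  linarith [mul_nonneg hb.le (sq_nonneg (x - xc α))]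

/-- `r_α` is also the maximum of `f_α` over `[0,1]`; if `α ∈ (1/9, 1)` then `r_α < 1`,
and if `α ∈ (0, 1/9)` then `r_α > 1`. -/
theorem r_alpha_vs_one (α : ℝ) (hα : α ∈ Set.Ioo (0 : ℝ) 1) :
    (∀ x ∈ Set.Icc (0 : ℝ) 1, f α x ≤ r α) ∧
    ((1 / 9 : ℝ) < α → r α < 1) ∧
    (α < (1 / 9 : ℝ) → 1 < r α) := by
  obtain ⟨h0, h1⟩ := hα
  obtain ⟨hc, hq⟩ := xc_pos_and_quadratic h0 h1
  have hhalf := xc_lt_half h0 h1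
  refine ⟨fun x _ => f_le_r h0 h1 x, fun h => ?_, fun h => ?_⟩
  · rw [r_eq h0 h1, div_lt_one (by positivity)]
    by_contra! hle
    have hsq : xc α ^ 2 ≤ (1 / 4) ^ 2 := pow_le_pow_left₀ hc.le (by linarith) 2
    have hl := mul_le_mul_of_nonneg_left hsq (sub_pos.mpr h1).le
    have hr := mul_le_mul_of_nonneg_left (show 1 / 2 ≤ 1 - 2 * xc α by linarith) h0.le
    linarith
  · rw [r_eq h0 h1, one_lt_div (by positivity)]
    by_contra! hle
    have hsq : (1 / 4) ^ 2 ≤ xc α ^ 2 := pow_le_pow_left₀ (by norm_num) (by linarith) 2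
    have hl := mul_le_mul_of_nonneg_left hsq (sub_pos.mpr h1).le
    have hr := mul_le_mul_of_nonneg_left (show 1 - 2 * xc α ≤ 1 / 2 by linarith) h0.le
    linarith
end

section
/- Let α ∈ (0, 1/9). Then the function g_α has a unique zero p_c(α) in the interval (x̄_α, 1). Furthermore, g_α(p) > 0 for every p ∈ [x̄_α, p_c(α)) and g_α(p) < 0 for every p ∈ (p_c(α), 1). -/
open Finset

/-- `x̲_α = (1/4)(1 − sqrt(1 − 8α/(1−α)))`. -/
noncomputable def xlo (α : ℝ) : ℝ := (1 / 4) * (1 - Real.sqrt (1 - 8 * α / (1 - α)))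

/-- `x̄_α = (1/4)(1 + sqrt(1 − 8α/(1−α)))`. -/
noncomputable def xhi (α : ℝ) : ℝ := (1 / 4) * (1 + Real.sqrt (1 - 8 * α / (1 - α)))

/-- `g_α(x) = ∫_{x̲_α}^{x} log(f_α(t)) dt`. -/
noncomputable def g (α x : ℝ) : ℝ := ∫ t in (xlo α)..x, Real.log (f α t)

/-- `log f_α` is integrable on every interval, its singularities being logarithmic. -/
lemma intervalIntegrable_log_f (α a b : ℝ) :
    IntervalIntegrable (fun t => Real.log (f α t)) MeasureTheory.volume a b := by
  have h : MeromorphicOn (f α) (Set.uIcc a b) := by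
    intro x _
    unfold f
    fun_prop
  exact h.intervalIntegrable_log

/-- `xlo α` and `xhi α` lie in `(0, 1)` and are the roots of `2x² - x + α/(1 - α)`. -/
lemma xlo_xhi_spec {α : ℝ} (hα : α ∈ Set.Ioo (0 : ℝ) (1 / 9)) :
    0 < xlo α ∧ xlo α < xhi α ∧ xhi α < 1 ∧
      ∀ x, α + (1 - α) * x ^ 2 - (1 - α) * x * (1 - x) =
        2 * (1 - α) * ((x - xlo α) * (x - xhi α)) := by
  obtain ⟨h0, h9⟩ := hα
  have h1 : 0 < 1 - α := by linarith
  have hc0 : 0 < 8 * α / (1 - α) := by positivity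
  have hc1 : 8 * α / (1 - α) < 1 := by rw [div_lt_one h1]; linarith
  have hs0 : 0 < Real.sqrt (1 - 8 * α / (1 - α)) := Real.sqrt_pos.2 (by linarith)
  have hsq : Real.sqrt (1 - 8 * α / (1 - α)) ^ 2 = 1 - 8 * α / (1 - α) :=
    Real.sq_sqrt (by linarith)
  have hs1 : Real.sqrt (1 - 8 * α / (1 - α)) < 1 := by nlinarith
  have hmul : (1 - α) * (8 * α / (1 - α)) = 8 * α := mul_div_cancel₀ _ h1.ne'
  unfold xlo xhi
  refine ⟨by linarith, by linarith, by linarith, fun x => ?_⟩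
  linear_combination (1 / 8) * (1 - α) * hsq - (1 / 8) * hmul

lemma log_f_pos {α x : ℝ} (hα : α ∈ Set.Ioo (0 : ℝ) (1 / 9))
    (hx : x ∈ Set.Ioo (xlo α) (xhi α)) : 0 < Real.log (f α x) := by
  obtain ⟨-, -, -, h⟩ := xlo_xhi_spec hα
  have h1 : 0 < 1 - α := by linarith [hα.2]
  have hD : 0 < α + (1 - α) * x ^ 2 := by have := hα.1; positivity
  refine Real.log_pos ((one_lt_div hD).2 ?_)
  have := mul_pos (mul_pos two_pos h1) (mul_pos (sub_pos.2 hx.1) (sub_pos.2 hx.2))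
  linarith [h x]

lemma log_f_neg {α x : ℝ} (hα : α ∈ Set.Ioo (0 : ℝ) (1 / 9))
    (hx : x ∈ Set.Ioo (xhi α) 1) : Real.log (f α x) < 0 := by
  obtain ⟨hl, hlh, -, h⟩ := xlo_xhi_spec hα
  have h1 : 0 < 1 - α := by linarith [hα.2]
  have hD : 0 < α + (1 - α) * x ^ 2 := by have := hα.1; positivity
  have hx0 : 0 < x := by linarith [hx.1]
  have hx1 : 0 < 1 - x := sub_pos.2 hx.2
  refine Real.log_neg (by unfold f; positivity) ((div_lt_one hD).2 ?_)
  have := mul_pos (mul_pos two_pos h1) (mul_pos (sub_pos.2 (hlh.trans hx.1)) (sub_pos.2 hx.1))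
  linarith [h x]

/-- On `(0, 1)`, `f_α` is bounded by its limit `(1 - x)/x` as `α → 0`. -/
lemma log_f_le {α x : ℝ} (hα : α ∈ Set.Ioo (0 : ℝ) (1 / 9)) (hx : x ∈ Set.Ioo (0 : ℝ) 1) :
    Real.log (f α x) ≤ Real.log (1 - x) - Real.log x := by
  have h0 := hα.1
  have hx0 := hx.1
  have h1 : 0 < 1 - α := by linarith [hα.2]
  have hx1 : 0 < 1 - x := sub_pos.2 hx.2
  have hD : 0 < α + (1 - α) * x ^ 2 := by positivity
  rw [← Real.log_div hx1.ne' hx0.ne']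
  refine Real.log_le_log (by unfold f; positivity) ?_
  unfold f
  rw [div_le_div_iff₀ hD hx0]
  nlinarith [mul_pos h0 hx1]

lemma intervalIntegrable_log_one_sub (a b : ℝ) :
    IntervalIntegrable (fun t => Real.log (1 - t)) MeasureTheory.volume a b := by
  have h : MeromorphicOn (fun t : ℝ => 1 - t) (Set.uIcc a b) := by
    intro x _
    fun_prop
  exact h.intervalIntegrable_log

lemma integral_log_one_sub_sub_log (a : ℝ) :
    ∫ t in a..1, (Real.log (1 - t) - Real.log t) =
      (1 - a) * Real.log (1 - a) + a * Real.log a := by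
  rw [intervalIntegral.integral_sub (intervalIntegrable_log_one_sub a 1)
      intervalIntegral.intervalIntegrable_log',
    intervalIntegral.integral_comp_sub_left (fun t => Real.log t), integral_log, integral_log]
  simp
  ring

lemma g_one_neg {α : ℝ} (hα : α ∈ Set.Ioo (0 : ℝ) (1 / 9)) : g α 1 < 0 := by
  obtain ⟨hl, hlh, hh, -⟩ := xlo_xhi_spec hα
  have hl1 : xlo α < 1 := hlh.trans hh
  have hle : g α 1 ≤ ∫ t in (xlo α)..1, (Real.log (1 - t) - Real.log t) :=
    intervalIntegral.integral_mono_on_of_le_Ioo hl1.le (intervalIntegrable_log_f α _ _)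
      ((intervalIntegrable_log_one_sub _ _).sub intervalIntegral.intervalIntegrable_log')
      fun x hx => log_f_le hα ⟨hl.trans hx.1, hx.2⟩
  rw [integral_log_one_sub_sub_log] at hle
  have h1 := mul_pos (sub_pos.2 hl1) (neg_pos.2 (Real.log_neg (sub_pos.2 hl1) (by linarith)))
  have h2 := mul_pos hl (neg_pos.2 (Real.log_neg hl hl1))
  linarith

lemma g_xhi_pos {α : ℝ} (hα : α ∈ Set.Ioo (0 : ℝ) (1 / 9)) : 0 < g α (xhi α) :=
  intervalIntegral.intervalIntegral_pos_of_pos_on (intervalIntegrable_log_f α _ _)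
    (fun _ hx => log_f_pos hα hx) (xlo_xhi_spec hα).2.1

lemma strictAntiOn_g {α : ℝ} (hα : α ∈ Set.Ioo (0 : ℝ) (1 / 9)) :
    StrictAntiOn (g α) (Set.Icc (xhi α) 1) := by
  intro p hp q hq hpq
  have hadd := intervalIntegral.integral_add_adjacent_intervals
    (intervalIntegrable_log_f α (xlo α) p) (intervalIntegrable_log_f α p q)
  have hpos : 0 < ∫ t in p..q, -Real.log (f α t) :=
    intervalIntegral.intervalIntegral_pos_of_pos_on (intervalIntegrable_log_f α p q).neg
      (fun x hx => neg_pos.2 (log_f_neg hα ⟨hp.1.trans_lt hx.1, hx.2.trans_le hq.2⟩)) hpq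
  rw [intervalIntegral.integral_neg] at hpos
  unfold g
  linarith

lemma continuous_g (α : ℝ) : Continuous (g α) :=
  intervalIntegral.continuous_primitive (intervalIntegrable_log_f α) (xlo α)

/-- For `α ∈ (0, 1/9)`, `g_α` has a unique zero `p_c(α)` in `(x̄_α, 1)`; moreover
`g_α > 0` on `[x̄_α, p_c(α))` and `g_α < 0` on `(p_c(α), 1)`. -/
theorem g_unique_zero (α : ℝ) (hα : α ∈ Set.Ioo (0 : ℝ) (1 / 9)) :
    ∃ pc ∈ Set.Ioo (xhi α) 1, g α pc = 0 ∧
      (∀ q ∈ Set.Ioo (xhi α) 1, g α q = 0 → q = pc) ∧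
      (∀ p ∈ Set.Ico (xhi α) pc, 0 < g α p) ∧
      (∀ p ∈ Set.Ioo pc 1, g α p < 0) := by
  obtain ⟨-, -, hh, -⟩ := xlo_xhi_spec hα
  have hanti := strictAntiOn_g hα
  obtain ⟨pc, hpc, hz⟩ := intermediate_value_Ioo' hh.le (continuous_g α).continuousOn
    ⟨g_one_neg hα, g_xhi_pos hα⟩
  have hpc' := Set.Ioo_subset_Icc_self hpc
  refine ⟨pc, hpc, hz, fun q hq hq0 => ?_, fun p hp => ?_, fun p hp => ?_⟩
  · exact hanti.injOn (Set.Ioo_subset_Icc_self hq) hpc' (hq0.trans hz.symm)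
  · exact hz ▸ hanti ⟨hp.1, (hp.2.trans hpc.2).le⟩ hpc' hp.2
  · exact hz ▸ hanti hpc' ⟨(hpc.1.trans hp.1).le, hp.2.le⟩ hp.1
end

section
/- Let α ∈ (0, 1/9]. For every x ∈ (0, 1), the integral g_α(x) = ∫_{x̲_α}^{x} log(f_α(t)) dt admits the closed form g_α(x) = x·log((1−α)x/(α+(1−α)x²)) − (1−x)·log(1−x) + log(1−x̲_α) − 2·sqrt(α/(1−α))·( arctan(sqrt((1−α)/α)·x) − arctan(sqrt((1−α)/α)·x̲_α) ). -/
open Finset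

/-- A primitive of `log ∘ f α` on `(0, 1)`. -/
noncomputable def logPrimitive (α t : ℝ) : ℝ :=
  t * Real.log ((1 - α) * t / (α + (1 - α) * t ^ 2)) - (1 - t) * Real.log (1 - t)
    - 2 * Real.sqrt (α / (1 - α)) * Real.arctan (Real.sqrt ((1 - α) / α) * t)

lemma add_one_sub_mul_sq_pos {α : ℝ} (h0 : 0 < α) (h1 : α < 1) (t : ℝ) :
    0 < α + (1 - α) * t ^ 2 := by
  have := mul_nonneg (sub_pos.2 h1).le (sq_nonneg t)
  linarith

lemma log_f_eq {α t : ℝ} (h0 : 0 < α) (h1 : α < 1) (ht : t ∈ Set.Ioo (0 : ℝ) 1) :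
    Real.log (f α t) =
      Real.log ((1 - α) * t / (α + (1 - α) * t ^ 2)) + Real.log (1 - t) := by
  have hD := add_one_sub_mul_sq_pos h0 h1 t
  have hα := sub_pos.2 h1
  have ht0 := ht.1
  rw [f, mul_div_right_comm, Real.log_mul (by positivity) (sub_pos.2 ht.2).ne']

lemma hasDerivAt_logPrimitive {α t : ℝ} (h0 : 0 < α) (h1 : α < 1)
    (ht : t ∈ Set.Ioo (0 : ℝ) 1) :
    HasDerivAt (logPrimitive α) (Real.log (f α t)) t := by
  have hD := add_one_sub_mul_sq_pos h0 h1 t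
  have hα : 0 < 1 - α := sub_pos.2 h1
  have ht0 : 0 < t := ht.1
  have ht1 : 0 < 1 - t := sub_pos.2 ht.2
  have hid := hasDerivAt_id' t
  have hq := ((hid.const_mul (1 - α)).div (((hid.pow 2).const_mul (1 - α)).const_add α)
    hD.ne').log (show (1 - α) * t / (α + (1 - α) * t ^ 2) ≠ 0 by positivity)
  have hl := (hid.const_sub 1).log ht1.ne'
  have ha := (hid.const_mul (Real.sqrt ((1 - α) / α))).arctan
  have h := ((hid.mul hq).sub ((hid.const_sub 1).mul hl)).sub
    (ha.const_mul (2 * Real.sqrt (α / (1 - α))))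
  refine h.congr_deriv ?_
  have hs : Real.sqrt (α / (1 - α)) * Real.sqrt ((1 - α) / α) = 1 := by
    rw [← Real.sqrt_mul (by positivity), div_mul_div_cancel₀ hα.ne', div_self h0.ne',
      Real.sqrt_one]
  have hk : 2 * Real.sqrt (α / (1 - α)) *
      (1 / (1 + (Real.sqrt ((1 - α) / α) * t) ^ 2) * (Real.sqrt ((1 - α) / α) * 1))
      = 2 * α / (α + (1 - α) * t ^ 2) := by
    calc _ = 2 * (Real.sqrt (α / (1 - α)) * Real.sqrt ((1 - α) / α)) /
          (1 + Real.sqrt ((1 - α) / α) ^ 2 * t ^ 2) := by rw [mul_pow]; ring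
      _ = _ := by
        rw [hs, Real.sq_sqrt (by positivity)]
        field_simp
  rw [hk, log_f_eq h0 h1 ht]
  simp only [Pi.div_apply, Pi.pow_apply]
  field_simp
  ring

lemma xlo_mem_Ioo {α : ℝ} (hα : α ∈ Set.Ioc (0 : ℝ) (1 / 9)) : xlo α ∈ Set.Ioo (0 : ℝ) 1 := by
  obtain ⟨h0, h9⟩ := hα
  have h1 : 0 < 1 - α := by linarith
  have hs : Real.sqrt (1 - 8 * α / (1 - α)) < 1 := by
    rw [Real.sqrt_lt' one_pos]
    have : 0 < 8 * α / (1 - α) := by positivity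
    linarith
  have := Real.sqrt_nonneg (1 - 8 * α / (1 - α))
  constructor <;> rw [xlo] <;> linarith

lemma f_xlo {α : ℝ} (hα : α ∈ Set.Ioc (0 : ℝ) (1 / 9)) : f α (xlo α) = 1 := by
  obtain ⟨h0, h9⟩ := hα
  have h1 : 0 < 1 - α := by linarith
  have hD := add_one_sub_mul_sq_pos h0 (by linarith) (xlo α)
  have hs : Real.sqrt (1 - 8 * α / (1 - α)) ^ 2 = 1 - 8 * α / (1 - α) := by
    apply Real.sq_sqrt
    rw [sub_nonneg, div_le_one h1]
    linarith
  have hx : Real.sqrt (1 - 8 * α / (1 - α)) = 1 - 4 * xlo α := by rw [xlo]; ring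
  rw [hx] at hs
  field_simp at hs
  rw [f, div_eq_one_iff_eq hD.ne']
  linarith

lemma logPrimitive_xlo {α : ℝ} (hα : α ∈ Set.Ioc (0 : ℝ) (1 / 9)) :
    logPrimitive α (xlo α) = -Real.log (1 - xlo α)
      - 2 * Real.sqrt (α / (1 - α)) * Real.arctan (Real.sqrt ((1 - α) / α) * xlo α) := by
  have h := log_f_eq hα.1 (by linarith [hα.2]) (xlo_mem_Ioo hα)
  rw [f_xlo hα, Real.log_one] at h
  rw [logPrimitive, eq_neg_of_add_eq_zero_left h.symm]
  ring

lemma continuousOn_log_f {α : ℝ} (h0 : 0 < α) (h1 : α < 1) :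
    ContinuousOn (fun t => Real.log (f α t)) (Set.Ioo 0 1) := by
  have hα := sub_pos.2 h1
  unfold f
  refine ContinuousOn.log (ContinuousOn.div (by fun_prop) (by fun_prop)
    fun t _ => (add_one_sub_mul_sq_pos h0 h1 t).ne') fun t ht => ?_
  have hD := add_one_sub_mul_sq_pos h0 h1 t
  have ht0 : 0 < t := ht.1
  have ht1 : 0 < 1 - t := sub_pos.2 ht.2
  positivity

/-- Closed form of `g_α(x)` for `α ∈ (0, 1/9]` and `x ∈ (0,1)`. -/
theorem g_closed_form (α : ℝ) (hα : α ∈ Set.Ioc (0 : ℝ) (1 / 9))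
    (x : ℝ) (hx : x ∈ Set.Ioo (0 : ℝ) 1) :
    g α x =
      x * Real.log ((1 - α) * x / (α + (1 - α) * x ^ 2))
        - (1 - x) * Real.log (1 - x) + Real.log (1 - xlo α)
        - 2 * Real.sqrt (α / (1 - α)) *
            (Real.arctan (Real.sqrt ((1 - α) / α) * x)
              - Real.arctan (Real.sqrt ((1 - α) / α) * xlo α)) := by
  have h1 : α < 1 := by linarith [hα.2]
  have hsub : Set.uIcc (xlo α) x ⊆ Set.Ioo 0 1 :=
    Set.ordConnected_Ioo.uIcc_subset (xlo_mem_Ioo hα) hx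
  rw [g, intervalIntegral.integral_eq_sub_of_hasDerivAt
    (fun t ht => hasDerivAt_logPrimitive hα.1 h1 (hsub ht))
    ((continuousOn_log_f hα.1 h1).mono hsub).intervalIntegrable,
    logPrimitive_xlo hα, logPrimitive]
  ring
end
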